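/- The su_q^P(3) coproduct respects the bracket of the two non-simple root generators: as functions on ℝ⁹×ℝ⁹ one has {Δ(a₁₃), Δ(a₃₁)} = sinh(z((h₁+h₁')−(h₃+h₃')))/z + z·sinh(z((h₁+h₁')−(h₂+h₂')))·Δ(a₂₃)Δ(a₃₂) + z·sinh(z((h₂+h₂')−(h₃+h₃')))·Δ(a₁₂)Δ(a₂₁), where the bracket on the left is the product Poisson bracket. -/

import Mathlib

/-- Partial derivative of a function on ℝ⁹ in the `i`-th coordinate direction.
Coordinates: (x 0,…,x 8) = (h₁,h₂,h₃,a₁₂,a₂₁,a₂₃,a₃₂,a₁₃,a₃₁). -/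
noncomputable def pd (i : Fin 9) (f : (Fin 9 → ℝ) → ℝ) (x : Fin 9 → ℝ) : ℝ :=
  fderiv ℝ f x (Pi.single i 1)

/-- The structure functions π(u,v) of su_q^P(3) for u < v (zero otherwise);
indices: 0=h₁, 1=h₂, 2=h₃, 3=a₁₂, 4=a₂₁, 5=a₂₃, 6=a₃₂, 7=a₁₃, 8=a₃₁. -/
noncomputable def piU (z : ℝ) (u v : ℕ) (x : Fin 9 → ℝ) : ℝ :=
  match u, v with
  | 0, 3 => x 3
  | 0, 4 => -x 4
  | 0, 7 => x 7
  | 0, 8 => -x 8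
  | 1, 3 => -x 3
  | 1, 4 => x 4
  | 1, 5 => x 5
  | 1, 6 => -x 6
  | 2, 5 => -x 5
  | 2, 6 => x 6
  | 2, 7 => -x 7
  | 2, 8 => x 8
  | 3, 4 => Real.sinh (z * (x 0 - x 1)) / z
  | 3, 5 => x 7
  | 3, 7 => z ^ 2 * x 3 ^ 2 * x 5
  | 3, 8 => -(Real.cosh (z * (x 0 - x 1)) * x 6)
  | 4, 6 => -x 8
  | 4, 7 => Real.cosh (z * (x 0 - x 1)) * x 5
  | 4, 8 => -(z ^ 2 * x 4 ^ 2 * x 6)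
  | 5, 6 => Real.sinh (z * (x 1 - x 2)) / z
  | 5, 7 => -(z ^ 2 * x 5 ^ 2 * x 3)
  | 5, 8 => Real.cosh (z * (x 1 - x 2)) * x 4
  | 6, 7 => -(Real.cosh (z * (x 1 - x 2)) * x 3)
  | 6, 8 => z ^ 2 * x 6 ^ 2 * x 4
  | 7, 8 => Real.sinh (z * (x 0 - x 2)) / z
      + z * Real.sinh (z * (x 0 - x 1)) * x 5 * x 6
      + z * Real.sinh (z * (x 1 - x 2)) * x 3 * x 4
  | _, _ => 0

/-- The bracket of the q-Poisson algebra su_q^P(3):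
{f,g} = Σ_{u<v} π(u,v)(∂_u f ∂_v g − ∂_v f ∂_u g). -/
noncomputable def suq3Bracket (z : ℝ) (f g : (Fin 9 → ℝ) → ℝ) (x : Fin 9 → ℝ) : ℝ :=
  ∑ u : Fin 9, ∑ v : Fin 9,
    if u < v then piU z u.val v.val x * (pd u f x * pd v g x - pd v f x * pd u g x)
    else 0

/-- The product Poisson bracket on ℝ⁹ × ℝ⁹. -/
noncomputable def suq3Bracket2 (z : ℝ) (F G : (Fin 9 → ℝ) × (Fin 9 → ℝ) → ℝ)
    (p : (Fin 9 → ℝ) × (Fin 9 → ℝ)) : ℝ :=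
  suq3Bracket z (fun y => F (y, p.2)) (fun y => G (y, p.2)) p.1
  + suq3Bracket z (fun y => F (p.1, y)) (fun y => G (p.1, y)) p.2

/-- Coproduct Δ(hᵢ) = hᵢ + hᵢ' (i = 0,1,2 standing for 1,2,3). -/
noncomputable def Dh (i : Fin 3) : (Fin 9 → ℝ) × (Fin 9 → ℝ) → ℝ := fun p =>
  p.1 ⟨i.val, by omega⟩ + p.2 ⟨i.val, by omega⟩

/-- Coproduct Δ(a₁₂). -/
noncomputable def Da12 (z : ℝ) : (Fin 9 → ℝ) × (Fin 9 → ℝ) → ℝ := fun p =>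
  Real.exp (z * (p.1 0 - p.1 1) / 2) * p.2 3
  + p.1 3 * Real.exp (-(z * (p.2 0 - p.2 1) / 2))

/-- Coproduct Δ(a₂₁). -/
noncomputable def Da21 (z : ℝ) : (Fin 9 → ℝ) × (Fin 9 → ℝ) → ℝ := fun p =>
  Real.exp (z * (p.1 0 - p.1 1) / 2) * p.2 4
  + p.1 4 * Real.exp (-(z * (p.2 0 - p.2 1) / 2))

/-- Coproduct Δ(a₂₃). -/
noncomputable def Da23 (z : ℝ) : (Fin 9 → ℝ) × (Fin 9 → ℝ) → ℝ := fun p =>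
  Real.exp (z * (p.1 1 - p.1 2) / 2) * p.2 5
  + p.1 5 * Real.exp (-(z * (p.2 1 - p.2 2) / 2))

/-- Coproduct Δ(a₃₂). -/
noncomputable def Da32 (z : ℝ) : (Fin 9 → ℝ) × (Fin 9 → ℝ) → ℝ := fun p =>
  Real.exp (z * (p.1 1 - p.1 2) / 2) * p.2 6
  + p.1 6 * Real.exp (-(z * (p.2 1 - p.2 2) / 2))

/-- Coproduct Δ(a₁₃). -/
noncomputable def Da13 (z : ℝ) : (Fin 9 → ℝ) × (Fin 9 → ℝ) → ℝ := fun p =>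
  Real.exp (z * (p.1 0 - p.1 2) / 2) * p.2 7
  + p.1 7 * Real.exp (-(z * (p.2 0 - p.2 2) / 2))
  + z * (Real.exp (z * (p.1 1 - p.1 2) / 2) * p.1 3
           * (Real.exp (-(z * (p.2 0 - p.2 1) / 2)) * p.2 5)
         - Real.exp (z * (p.1 0 - p.1 1) / 2) * p.1 5
           * (Real.exp (-(z * (p.2 1 - p.2 2) / 2)) * p.2 3))

/-- Coproduct Δ(a₃₁). -/
noncomputable def Da31 (z : ℝ) : (Fin 9 → ℝ) × (Fin 9 → ℝ) → ℝ := fun p =>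
  Real.exp (z * (p.1 0 - p.1 2) / 2) * p.2 8
  + p.1 8 * Real.exp (-(z * (p.2 0 - p.2 2) / 2))
  + z * (Real.exp (z * (p.1 1 - p.1 2) / 2) * p.1 4
           * (Real.exp (-(z * (p.2 0 - p.2 1) / 2)) * p.2 6)
         - Real.exp (z * (p.1 0 - p.1 1) / 2) * p.1 6
           * (Real.exp (-(z * (p.2 1 - p.2 2) / 2)) * p.2 4))

/-- Gradient of the functions of the first tensor factor occurring in `Δ(a₁₃)` and `Δ(a₃₁)`. -/
theorem pd_fst_slice (z A M P Q : ℝ) (k l m i : Fin 9) (x : Fin 9 → ℝ) :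
    pd i (fun y => Real.exp (z * (y 0 - y 2) / 2) * A + y k * M
      + z * (Real.exp (z * (y 1 - y 2) / 2) * y l * P
        - Real.exp (z * (y 0 - y 1) / 2) * y m * Q)) x
      = Real.exp (z * (x 0 - x 2) / 2)
            * (z * ((Pi.single i 1 : Fin 9 → ℝ) 0 - (Pi.single i 1 : Fin 9 → ℝ) 2) / 2) * A
        + (Pi.single i 1 : Fin 9 → ℝ) k * M
        + z * (Real.exp (z * (x 1 - x 2) / 2)
            * (z * ((Pi.single i 1 : Fin 9 → ℝ) 1 - (Pi.single i 1 : Fin 9 → ℝ) 2) / 2 * x l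
              + (Pi.single i 1 : Fin 9 → ℝ) l) * P
          - Real.exp (z * (x 0 - x 1) / 2)
            * (z * ((Pi.single i 1 : Fin 9 → ℝ) 0 - (Pi.single i 1 : Fin 9 → ℝ) 1) / 2 * x m
              + (Pi.single i 1 : Fin 9 → ℝ) m) * Q) := by
  have hc (j : Fin 9) := hasFDerivAt_apply (𝕜 := ℝ) j x
  have he (a b : Fin 9) : HasFDerivAt (fun y : Fin 9 → ℝ => Real.exp (z * (y a - y b) / 2)) _ x :=
    ((((hc a).sub (hc b)).const_mul z).mul_const (2⁻¹ : ℝ)).exp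
  have h := (((he 0 2).mul_const A).add ((hc k).mul_const M)).add
    (((((he 1 2).mul (hc l)).mul_const P).sub
      (((he 0 1).mul (hc m)).mul_const Q)).const_mul z)
  refine (DFunLike.congr_fun (HasFDerivAt.fderiv h) (Pi.single i 1)).trans ?_
  simp [← div_eq_mul_inv]
  ring

/-- Gradient of the functions of the second tensor factor occurring in `Δ(a₁₃)` and `Δ(a₃₁)`. -/
theorem pd_snd_slice (z A M P Q : ℝ) (k l m i : Fin 9) (x : Fin 9 → ℝ) :
    pd i (fun y => A * y k + M * Real.exp (-(z * (y 0 - y 2) / 2))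
      + z * (P * (Real.exp (-(z * (y 0 - y 1) / 2)) * y l)
        - Q * (Real.exp (-(z * (y 1 - y 2) / 2)) * y m))) x
      = A * (Pi.single i 1 : Fin 9 → ℝ) k
        - M * (Real.exp (-(z * (x 0 - x 2) / 2))
            * (z * ((Pi.single i 1 : Fin 9 → ℝ) 0 - (Pi.single i 1 : Fin 9 → ℝ) 2) / 2))
        + z * (P * (Real.exp (-(z * (x 0 - x 1) / 2))
            * ((Pi.single i 1 : Fin 9 → ℝ) l
              - z * ((Pi.single i 1 : Fin 9 → ℝ) 0 - (Pi.single i 1 : Fin 9 → ℝ) 1) / 2 * x l))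
          - Q * (Real.exp (-(z * (x 1 - x 2) / 2))
            * ((Pi.single i 1 : Fin 9 → ℝ) m
              - z * ((Pi.single i 1 : Fin 9 → ℝ) 1 - (Pi.single i 1 : Fin 9 → ℝ) 2) / 2
                * x m))) := by
  have hc (j : Fin 9) := hasFDerivAt_apply (𝕜 := ℝ) j x
  have he (a b : Fin 9) :
      HasFDerivAt (fun y : Fin 9 → ℝ => Real.exp (-(z * (y a - y b) / 2))) _ x :=
    ((((hc a).sub (hc b)).const_mul z).mul_const (2⁻¹ : ℝ)).neg.exp
  have h := (((hc k).const_mul A).add ((he 0 2).const_mul M)).add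
    (((((he 0 1).mul (hc l)).const_mul P).sub
      (((he 1 2).mul (hc m)).const_mul Q)).const_mul z)
  refine (DFunLike.congr_fun (HasFDerivAt.fderiv h) (Pi.single i 1)).trans ?_
  simp [← div_eq_mul_inv]
  ring

/-- The bracket, written out over the nonzero structure functions. -/
theorem suq3Bracket_eq (z : ℝ) (f g : (Fin 9 → ℝ) → ℝ) (x : Fin 9 → ℝ) :
    suq3Bracket z f g x =
      let w : Fin 9 → Fin 9 → ℝ := fun u v => pd u f x * pd v g x - pd v f x * pd u g x
      x 3 * (w 0 3 - w 1 3) - x 4 * (w 0 4 - w 1 4)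
        + x 5 * (w 1 5 - w 2 5) - x 6 * (w 1 6 - w 2 6)
        + x 7 * (w 0 7 - w 2 7) - x 8 * (w 0 8 - w 2 8)
        + Real.sinh (z * (x 0 - x 1)) / z * w 3 4 + x 7 * w 3 5
        + z ^ 2 * x 3 ^ 2 * x 5 * w 3 7 - Real.cosh (z * (x 0 - x 1)) * x 6 * w 3 8
        - x 8 * w 4 6 + Real.cosh (z * (x 0 - x 1)) * x 5 * w 4 7
        - z ^ 2 * x 4 ^ 2 * x 6 * w 4 8 + Real.sinh (z * (x 1 - x 2)) / z * w 5 6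
        - z ^ 2 * x 5 ^ 2 * x 3 * w 5 7 + Real.cosh (z * (x 1 - x 2)) * x 4 * w 5 8
        - Real.cosh (z * (x 1 - x 2)) * x 3 * w 6 7 + z ^ 2 * x 6 ^ 2 * x 4 * w 6 8
        + (Real.sinh (z * (x 0 - x 2)) / z + z * Real.sinh (z * (x 0 - x 1)) * x 5 * x 6
          + z * Real.sinh (z * (x 1 - x 2)) * x 3 * x 4) * w 7 8 := by
  extract_lets w
  have h : suq3Bracket z f g x =
      ∑ u : Fin 9, ∑ v : Fin 9, if u < v then piU z u.val v.val x * w u v else 0 := rfl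
  clear_value w
  rw [h]
  have sum_nine (φ : Fin 9 → ℝ) :
      ∑ i, φ i = φ 0 + φ 1 + φ 2 + φ 3 + φ 4 + φ 5 + φ 6 + φ 7 + φ 8 := by
    rw [Fin.sum_univ_castSucc, Fin.sum_univ_eight]
    rfl
  simp only [sum_nine, Fin.reduceLT, ↓reduceIte, Fin.coe_ofNat_eq_mod, Nat.reduceMod, piU,
    zero_mul, add_zero, zero_add, lt_self_iff_false]
  ring

/-- the su_q^P(3) coproduct respects the bracket of the two
non-simple root generators. -/
theorem suq3_coproduct_f13f31 (z : ℝ) (hz : z ≠ 0) :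
    ∀ p : (Fin 9 → ℝ) × (Fin 9 → ℝ),
      suq3Bracket2 z (Da13 z) (Da31 z) p
        = Real.sinh (z * ((p.1 0 + p.2 0) - (p.1 2 + p.2 2))) / z
          + z * Real.sinh (z * ((p.1 0 + p.2 0) - (p.1 1 + p.2 1)))
              * (Da23 z p * Da32 z p)
          + z * Real.sinh (z * ((p.1 1 + p.2 1) - (p.1 2 + p.2 2)))
              * (Da12 z p * Da21 z p) := by
  rintro ⟨x, y⟩
  have hx : Real.exp (z * (x 0 - x 2) / 2)
      = Real.exp (z * (x 0 - x 1) / 2) * Real.exp (z * (x 1 - x 2) / 2) := by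
    rw [← Real.exp_add]; ring_nf
  have hy : Real.exp (z * (y 0 - y 2) / 2)
      = Real.exp (z * (y 0 - y 1) / 2) * Real.exp (z * (y 1 - y 2) / 2) := by
    rw [← Real.exp_add]; ring_nf
  have hsq (t : ℝ) : Real.exp t = Real.exp (t / 2) ^ 2 := by
    rw [← Real.exp_nat_mul]; push_cast; ring_nf
  have hsinh (t : ℝ) : Real.sinh t = (Real.exp (t / 2) ^ 2 - (Real.exp (t / 2) ^ 2)⁻¹) / 2 := by
    rw [Real.sinh_eq, Real.exp_neg, ← hsq]
  have hcosh (t : ℝ) : Real.cosh t = (Real.exp (t / 2) ^ 2 + (Real.exp (t / 2) ^ 2)⁻¹) / 2 := by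
    rw [Real.cosh_eq, Real.exp_neg, ← hsq]
  have hadd (i j : Fin 9) : Real.exp (z * ((x i + y i) - (x j + y j)) / 2)
      = Real.exp (z * (x i - x j) / 2) * Real.exp (z * (y i - y j) / 2) := by
    rw [← Real.exp_add]; ring_nf
  simp only [suq3Bracket2, suq3Bracket_eq, Da13, Da31, Da12, Da21, Da23, Da32,
    pd_fst_slice, pd_snd_slice]
  simp only [Pi.single_apply, Fin.reduceEq, ↓reduceIte, mul_zero, zero_mul, add_zero, zero_add,
    sub_zero, zero_sub, mul_one, zero_div, sub_self]
  simp only [hsinh, hcosh, hadd, Real.exp_neg, hx, hy]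
  have ha := Real.exp_ne_zero (z * (x 0 - x 1) / 2)
  have hb := Real.exp_ne_zero (z * (x 1 - x 2) / 2)
  have hc := Real.exp_ne_zero (z * (y 0 - y 1) / 2)
  have hd := Real.exp_ne_zero (z * (y 1 - y 2) / 2)
  generalize Real.exp (z * (x 0 - x 1) / 2) = a at ha ⊢
  generalize Real.exp (z * (x 1 - x 2) / 2) = b at hb ⊢
  generalize Real.exp (z * (y 0 - y 1) / 2) = c at hc ⊢
  generalize Real.exp (z * (y 1 - y 2) / 2) = d at hd ⊢
  clear hx hy hsq hsinh hcosh hadd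
  field_simp
  ring
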